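/- Let T ⊂ ℙ²(ℝ) be a set of exactly 8 points such that no 4 points of T lie on a line and no 7 points of T lie on a conic. Then every psd sextic form g lying in I₃(T)² can be written as g = c₁² + c₂² where c₁ and c₂ are cubic forms vanishing at every point of T. In particular, the sos sextic forms vanishing on T are exactly the psd forms in I₃(T)². -/

import Mathlib

open MvPolynomial

noncomputable section

/-- The real projective plane, as lines through the origin of `ℝ³`. -/
abbrev P2 := Projectivization ℝ (Fin 3 → ℝ)

/-- A polynomial is psd if it takes only nonnegative values on `ℝ³`. -/
def Psd (g : MvPolynomial (Fin 3) ℝ) : Prop := ∀ u : Fin 3 → ℝ, 0 ≤ eval u g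

/-- A polynomial is sos if it is a finite sum of squares. -/
def Sos (g : MvPolynomial (Fin 3) ℝ) : Prop :=
  ∃ (n : ℕ) (h : Fin n → MvPolynomial (Fin 3) ℝ), g = ∑ i, (h i) ^ 2

/-- A form vanishes at a point of `ℙ²(ℝ)` if it vanishes at a representative vector. -/
def VanishAt (g : MvPolynomial (Fin 3) ℝ) (P : P2) : Prop := eval P.rep g = 0

/-- A form is singular at a point of `ℙ²(ℝ)` if it and all its first partial
derivatives vanish at a representative vector. -/
def SingAt (g : MvPolynomial (Fin 3) ℝ) (P : P2) : Prop :=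
  eval P.rep g = 0 ∧ ∀ i, eval P.rep (pderiv i g) = 0

/-- `I_d(T)`: the space of degree-`d` forms vanishing at every point of `T`. -/
def Isub (d : ℕ) (T : Set P2) : Submodule ℝ (MvPolynomial (Fin 3) ℝ) :=
  (homogeneousSubmodule (Fin 3) ℝ d) ⊓
  { carrier := {f | ∀ P ∈ T, VanishAt f P}
    zero_mem' := by intro P _; simp [VanishAt]
    add_mem' := by
      intro a b ha hb P hP
      have h1 := ha P hP; have h2 := hb P hP
      unfold VanishAt at *; simp [h1, h2]
    smul_mem' := by
      intro c f hf P hP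
      have h1 := hf P hP
      unfold VanishAt at *; simp [smul_eq_C_mul, h1] }

/-- `I_d(2T)`: the space of degree-`d` forms singular at every point of `T`. -/
def Isub2 (d : ℕ) (T : Set P2) : Submodule ℝ (MvPolynomial (Fin 3) ℝ) :=
  (homogeneousSubmodule (Fin 3) ℝ d) ⊓
  { carrier := {f | ∀ P ∈ T, SingAt f P}
    zero_mem' := by intro P _; constructor <;> simp [SingAt]
    add_mem' := by
      intro a b ha hb P hP
      obtain ⟨h1, h2⟩ := ha P hP; obtain ⟨h3, h4⟩ := hb P hP
      exact ⟨by simp [h1, h3], fun i => by simp [h2 i, h4 i]⟩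
    smul_mem' := by
      intro c f hf P hP
      obtain ⟨h1, h2⟩ := hf P hP
      refine ⟨by simp [smul_eq_C_mul, h1], fun i => ?_⟩
      have := h2 i
      simp [smul_eq_C_mul, this] }

/-- `I₃(T)²`: the span of products of two cubics vanishing on `T`. -/
def IsqCubic (T : Set P2) : Submodule ℝ (MvPolynomial (Fin 3) ℝ) :=
  Submodule.span ℝ {h | ∃ f₁ ∈ Isub 3 T, ∃ f₂ ∈ Isub 3 T, h = f₁ * f₂}

/-- No 4 points of `T` on a line, no 7 on a conic. -/
def GenPos (T : Set P2) : Prop :=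
  (∀ l : MvPolynomial (Fin 3) ℝ, l ≠ 0 → l.IsHomogeneous 1 →
    {P ∈ T | VanishAt l P}.encard ≤ 3) ∧
  (∀ c : MvPolynomial (Fin 3) ℝ, c ≠ 0 → c.IsHomogeneous 2 →
    {P ∈ T | VanishAt c P}.encard ≤ 6)

/-- The real projective zero set of `g`. -/
def VR (g : MvPolynomial (Fin 3) ℝ) : Set P2 := {P | VanishAt g P}


theorem hom_aeval {A : Type*} [CommRing A] [Algebra ℝ A] {σ : Type*} {p : MvPolynomial σ ℝ} {n : ℕ}
    (hp : p.IsHomogeneous n) (a : A) (y : σ → A) :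
    aeval (fun i => a * y i) p = a ^ n * aeval y p := by
  rw [aeval_def, aeval_def, eval₂_eq, eval₂_eq, Finset.mul_sum]
  refine Finset.sum_congr rfl fun d hd => ?_
  have h : d.degree = n := by
    by_contra h
    exact (mem_support_iff.1 hd) (hp.coeff_eq_zero h)
  simp only [mul_pow, Finset.prod_mul_distrib]
  rw [Finset.prod_pow_eq_pow_sum, ← Finsupp.degree_apply, h]
  ring

theorem hom_eval {p : MvPolynomial (Fin 3) ℝ} {n : ℕ}
    (hp : p.IsHomogeneous n) (a : ℝ) (y : Fin 3 → ℝ) :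
    eval (a • y) p = a ^ n * eval y p := by
  have := hom_aeval hp a y
  simpa [aeval_eq_eval, Pi.smul_def] using this

/-- Grading homomorphism `X i ↦ X i * T`. -/
def gr : MvPolynomial (Fin 3) ℝ →ₐ[ℝ] Polynomial (MvPolynomial (Fin 3) ℝ) :=
  aeval (fun i => Polynomial.X * Polynomial.C (X i))

theorem gr_hom {p : MvPolynomial (Fin 3) ℝ} {n : ℕ} (hp : p.IsHomogeneous n) :
    gr p = Polynomial.X ^ n * Polynomial.C p := by
  unfold gr
  rw [hom_aeval hp]
  congr 1
  have : (fun i : Fin 3 => (Polynomial.C (X i) : Polynomial (MvPolynomial (Fin 3) ℝ))) =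
    fun i => (Polynomial.CAlgHom (R := ℝ) (A := MvPolynomial (Fin 3) ℝ)) (X i) := rfl
  rw [this, ← comp_aeval_apply]
  simp

theorem gr_coeff (p : MvPolynomial (Fin 3) ℝ) (n : ℕ) :
    (gr p).coeff n = homogeneousComponent n p := by
  conv_lhs => rw [← sum_homogeneousComponent p]
  rw [map_sum, Polynomial.finsetSum_coeff]
  simp only [gr_hom (homogeneousComponent_isHomogeneous _ p), Polynomial.coeff_X_pow_mul',
    Polynomial.coeff_C]
  by_cases h : n ∈ Finset.range (p.totalDegree + 1)
  · rw [Finset.sum_eq_single n]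
    · simp
    · intro b _ hb
      split_ifs <;> first | rfl | omega
    · exact fun h' => absurd h h'
  · rw [Finset.sum_eq_zero]
    · rw [homogeneousComponent_eq_zero]
      simpa using h
    · intro b hb
      split_ifs with h1 h2
      · exfalso
        have : n = b := by omega
        exact h (this ▸ hb)
      · rfl
      · rfl

theorem hom_of_gr {p : MvPolynomial (Fin 3) ℝ} {n : ℕ}
    (h : ∀ k, k ≠ n → (gr p).coeff k = 0) : p.IsHomogeneous n := by
  have : p = homogeneousComponent n p := by
    conv_lhs => rw [← sum_homogeneousComponent p]
    by_cases hn : n ∈ Finset.range (p.totalDegree + 1)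
    · rw [Finset.sum_eq_single n]
      · intro b _ hb
        rw [← gr_coeff]; exact h b hb
      · exact fun h' => absurd hn h'
    · rw [Finset.sum_eq_zero, homogeneousComponent_eq_zero]
      · simpa using hn
      · intro b hb
        rw [← gr_coeff]; apply h
        rintro rfl; exact hn hb
  rw [this]; exact homogeneousComponent_isHomogeneous _ _

theorem gr_ne_zero {p : MvPolynomial (Fin 3) ℝ} (hp : p ≠ 0) : gr p ≠ 0 := by
  intro h
  apply hp
  rw [← sum_homogeneousComponent p]
  refine Finset.sum_eq_zero fun i _ => ?_
  rw [← gr_coeff, h]; simp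

theorem hom_factor {f h k : MvPolynomial (Fin 3) ℝ} {n : ℕ} (hf : f.IsHomogeneous n) (hf0 : f ≠ 0)
    (e : f = h * k) : ∃ m, h.IsHomogeneous m := by
  have hh : h ≠ 0 := by rintro rfl; simp at e; exact hf0 e
  have hk : k ≠ 0 := by rintro rfl; simp at e; exact hf0 e
  have h1 : gr h * gr k = Polynomial.X ^ n * Polynomial.C f := by
    rw [← gr_hom hf, e, map_mul]
  have h2 := gr_ne_zero hh
  have h3 := gr_ne_zero hk
  have d1 := congrArg Polynomial.natDegree h1
  have d2 := congrArg Polynomial.natTrailingDegree h1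
  have hC : (Polynomial.C f : Polynomial (MvPolynomial (Fin 3) ℝ)) ≠ 0 := by simpa using hf0
  rw [Polynomial.natDegree_mul h2 h3, Polynomial.natDegree_mul (by simp) hC] at d1
  rw [Polynomial.natTrailingDegree_mul h2 h3, Polynomial.natTrailingDegree_mul (by simp) hC] at d2
  simp at d1 d2
  have e1 := Polynomial.natTrailingDegree_le_natDegree (gr h)
  have e2 := Polynomial.natTrailingDegree_le_natDegree (gr k)
  refine ⟨(gr h).natDegree, hom_of_gr fun j hj => ?_⟩
  rcases lt_or_gt_of_ne hj with h4 | h4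
  · apply Polynomial.coeff_eq_zero_of_lt_natTrailingDegree; omega
  · exact Polynomial.coeff_eq_zero_of_natDegree_lt h4

theorem ex_eval_ne {p : MvPolynomial (Fin 3) ℝ} (hp : p ≠ 0) : ∃ u, eval u p ≠ 0 := by
  by_contra! h
  exact hp (MvPolynomial.funext fun u => by simp [h u])

theorem hom_right {f h k : MvPolynomial (Fin 3) ℝ} {n m : ℕ} (hf : f.IsHomogeneous (m + n))
    (hh : h.IsHomogeneous m) (hh0 : h ≠ 0)
    (e : f = h * k) : k.IsHomogeneous n := by
  by_cases hk : k = 0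
  · subst hk; exact isHomogeneous_zero _ _ _
  have hf0 : f ≠ 0 := by rw [e]; exact mul_ne_zero hh0 hk
  obtain ⟨j, hj⟩ := hom_factor hf hf0 (e.trans (mul_comm _ _))
  have h1 : f.IsHomogeneous (m + j) := e ▸ hh.mul hj
  have := hf.inj_right h1 hf0
  have : n = j := by omega
  exact this ▸ hj

/-! sums of squares -/

theorem uni_sos {ι : Type*} (s : Finset ι) (p : ι → Polynomial ℝ) (c : ℝ) (k : ℕ)
    (h : ∑ i ∈ s, p i ^ 2 = Polynomial.C c * Polynomial.X ^ (2 * k)) :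
    ∀ i ∈ s, ∀ j, j ≠ k → (p i).coeff j = 0 := by
  induction k generalizing p with
  | zero =>
    intro i hi j hj
    have hb : (p i).degree ≤ 0 := by
      rw [← Polynomial.isBoundedUnder_abs_atTop_iff]
      refine ⟨|c| + 1, ?_⟩
      simp only [Filter.eventually_map]
      refine Filter.Eventually.of_forall fun x => ?_
      have h1 := congrArg (Polynomial.eval x) h
      simp [Polynomial.eval_finsetSum] at h1
      have h2 : (Polynomial.eval x (p i)) ^ 2 ≤ c := by
        rw [← h1]
        exact Finset.single_le_sum (f := fun i => (Polynomial.eval x (p i)) ^ 2)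
          (fun i _ => sq_nonneg _) hi
      have := le_abs_self c
      apply abs_le_of_sq_le_sq _ (by positivity)
      nlinarith [abs_nonneg c]
    apply Polynomial.coeff_eq_zero_of_degree_lt
    refine lt_of_le_of_lt hb ?_
    exact_mod_cast Nat.pos_of_ne_zero hj
  | succ k ih =>
    have h0 : ∀ i ∈ s, (p i).coeff 0 = 0 := by
      have h1 := congrArg (Polynomial.eval 0) h
      simp [Polynomial.eval_finsetSum] at h1
      rw [Finset.sum_eq_zero_iff_of_nonneg (fun i _ => sq_nonneg _)] at h1
      intro i hi
      have := h1 i hi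
      rw [Polynomial.coeff_zero_eq_eval_zero]
      simpa using this
    have h1 : ∀ i ∈ s, p i = Polynomial.X * (p i).divX := by
      intro i hi
      conv_lhs => rw [← Polynomial.X_mul_divX_add (p i), h0 i hi]
      simp
    have h2 : ∑ i ∈ s, (p i).divX ^ 2 = Polynomial.C c * Polynomial.X ^ (2 * k) := by
      have hX : (Polynomial.X : Polynomial ℝ) ^ 2 ≠ 0 := by simp
      apply mul_left_cancel₀ hX
      rw [Finset.mul_sum]
      calc _ = ∑ i ∈ s, p i ^ 2 := Finset.sum_congr rfl fun i hi => by
            conv_rhs => rw [h1 i hi]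
            ring
        _ = _ := by rw [h]; ring
    intro i hi j hj
    rcases j with _ | j
    · exact h0 i hi
    · have := ih _ h2 i hi j (by omega)
      rwa [Polynomial.coeff_divX] at this

theorem sos_hom {n : ℕ} {h : Fin n → MvPolynomial (Fin 3) ℝ} {g : MvPolynomial (Fin 3) ℝ}
    (hg : g.IsHomogeneous 6) (e : g = ∑ i, h i ^ 2) (i : Fin n) : (h i).IsHomogeneous 3 := by
  apply hom_of_gr
  intro k hk
  by_contra hne
  obtain ⟨u, hu⟩ := ex_eval_ne hne
  apply hu
  have h1 : ∑ i, ((gr (h i)).map (eval u)) ^ 2 = Polynomial.C (eval u g) * Polynomial.X ^ (2 * 3) := by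
    have := congrArg (Polynomial.map (eval u)) (congrArg gr e)
    rw [gr_hom hg] at this
    simp [Polynomial.map_sum] at this
    rw [← this]
  have := uni_sos Finset.univ _ _ 3 h1 i (Finset.mem_univ _) k hk
  simpa using this

open Polynomial in
theorem relPrime_bezout {R : Type*} [CommRing R] [IsDomain R] [UniqueFactorizationMonoid R]
    {c d : Polynomial R} (hc : c ≠ 0) (h : IsRelPrime c d) :
    ∃ (a b : Polynomial R) (r : R), r ≠ 0 ∧ a * c + b * d = Polynomial.C r := by
  let K := FractionRing R
  let : NormalizedGCDMonoid R := Nonempty.some inferInstance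
  have hinj : Function.Injective (algebraMap R K) := IsFractionRing.injective R K
  have hrel : IsRelPrime (c.map (algebraMap R K)) (d.map (algebraMap R K)) := by
    intro q hq1 hq2
    have hq0 : q ≠ 0 := by
      rintro rfl
      apply hc
      rw [zero_dvd_iff] at hq1
      exact Polynomial.map_injective _ hinj (by simpa using hq1)
    obtain ⟨b, hb, hb2⟩ := IsLocalization.integerNormalization_spec (nonZeroDivisors R) q
    set N := IsLocalization.integerNormalization (nonZeroDivisors R) q with hN
    have hb0 : algebraMap R K b ≠ 0 := by
      intro h0
      exact nonZeroDivisors.ne_zero hb (hinj (by simpa using h0))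
    have hdv : N.primPart.map (algebraMap R K) ∣ q := by
      have h1 : N.primPart.map (algebraMap R K) ∣ N.map (algebraMap R K) :=
        Polynomial.map_dvd _ N.primPart_dvd
      rw [hb2, Algebra.smul_def, Polynomial.algebraMap_apply] at h1
      have hu : IsUnit (Polynomial.C (algebraMap R K b)) :=
        Polynomial.isUnit_C.2 (isUnit_iff_ne_zero.2 hb0)
      exact (hu.dvd_mul_left).1 h1
    apply Polynomial.isUnit_or_eq_zero_of_isUnit_integerNormalization_primPart (R := R) hq0
    apply h
    · exact N.isPrimitive_primPart.dvd_of_fraction_map_dvd_fraction_map (hdv.trans hq1)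
    · exact N.isPrimitive_primPart.dvd_of_fraction_map_dvd_fraction_map (hdv.trans hq2)
  obtain ⟨A, B, hAB⟩ := hrel.isCoprime
  obtain ⟨α, hα, hα2⟩ := IsLocalization.integerNormalization_spec (nonZeroDivisors R) A
  obtain ⟨β, hβ, hβ2⟩ := IsLocalization.integerNormalization_spec (nonZeroDivisors R) B
  refine ⟨Polynomial.C β * IsLocalization.integerNormalization (nonZeroDivisors R) A,
    Polynomial.C α * IsLocalization.integerNormalization (nonZeroDivisors R) B, α * β,
    mul_ne_zero (nonZeroDivisors.ne_zero hα) (nonZeroDivisors.ne_zero hβ), ?_⟩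
  apply Polynomial.map_injective (algebraMap R K) hinj
  rw [Algebra.smul_def, Polynomial.algebraMap_apply] at hα2 hβ2
  simp only [Polynomial.map_add, Polynomial.map_mul, Polynomial.map_C, hα2, hβ2, map_mul]
  linear_combination (Polynomial.C (algebraMap R K α) * Polynomial.C (algebraMap R K β)) * hAB

/-- shear homomorphism -/
def shHom (w : Fin 3 → ℝ) : MvPolynomial (Fin 3) ℝ →ₐ[ℝ] MvPolynomial (Fin 3) ℝ :=
  aeval (fun i => X i + C (w i) * X 0)

theorem shHom_comp (w w' : Fin 3 → ℝ) (h0 : w' 0 = 0) (h : w + w' = 0) :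
    (shHom w').comp (shHom w) = AlgHom.id ℝ _ := by
  ext1 i
  have : w i + w' i = 0 := congrFun h i
  have h2 : (C (w i) : MvPolynomial (Fin 3) ℝ) + C (w' i) = 0 := by rw [← C_add, this, C_0]
  simp [shHom, h0, algebraMap_eq]
  linear_combination X 0 * h2

/-- shear as an equivalence -/
def sh (w : Fin 3 → ℝ) (h0 : w 0 = 0) : MvPolynomial (Fin 3) ℝ ≃ₐ[ℝ] MvPolynomial (Fin 3) ℝ :=
  AlgEquiv.ofAlgHom (shHom w) (shHom (-w))
    (shHom_comp _ _ h0 (by simp)) (shHom_comp _ _ (by simp [h0]) (by simp))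

theorem eval_sh (w : Fin 3 → ℝ) (h0 : w 0 = 0) (x : Fin 3 → ℝ) (c : MvPolynomial (Fin 3) ℝ) :
    eval x (sh w h0 c) = eval (x + x 0 • w) c := by
  change eval x (aeval (fun i => X i + C (w i) * X 0) c) = _
  rw [← aeval_eq_eval, comp_aeval_apply, ← aeval_eq_eval]
  congr 2
  ext i
  simp; ring

theorem exists_zero_ne {c d : MvPolynomial (Fin 3) ℝ} (hc : c.IsHomogeneous 3) (hc0 : c ≠ 0)
    (hcd : IsRelPrime c d) : ∃ u, eval u c = 0 ∧ eval u d ≠ 0 := by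
  by_contra! hcon
  obtain ⟨u, hu⟩ := ex_eval_ne (mul_ne_zero hc0 (X_ne_zero (R := ℝ) (0 : Fin 3)))
  simp only [map_mul, eval_X, mul_ne_zero_iff] at hu
  obtain ⟨v, hv0, hv⟩ : ∃ v : Fin 3 → ℝ, v 0 = 1 ∧ eval v c ≠ 0 := by
    refine ⟨(u 0)⁻¹ • u, by simp [hu.2], ?_⟩
    rw [hom_eval hc]
    exact mul_ne_zero (pow_ne_zero _ (inv_ne_zero hu.2)) hu.1
  set w : Fin 3 → ℝ := v - Pi.single 0 1 with hw
  have hw0 : w 0 = 0 := by simp [hw, hv0]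
  let Ψ := (sh w hw0).trans (finSuccEquiv ℝ 2)
  have hrel : IsRelPrime (Ψ c) (Ψ d) := by
    intro q h1 h2
    have h3 : IsUnit (Ψ.symm q) := by
      apply hcd
      · have := map_dvd Ψ.symm h1; simpa using this
      · have := map_dvd Ψ.symm h2; simpa using this
    have := h3.map Ψ; simpa using this
  have hΨ0 : Ψ c ≠ 0 := by simpa using hc0
  obtain ⟨a, b, r, hr, hab⟩ := relPrime_bezout hΨ0 hrel
  obtain ⟨x, hx⟩ : ∃ x, eval x r ≠ 0 := by
    by_contra! h
    exact hr (MvPolynomial.funext fun u => by simp [h u])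
  have key : ∀ (t : ℝ) (p : MvPolynomial (Fin 3) ℝ),
      Polynomial.eval t ((Ψ p).map (eval x)) = eval (Fin.cons 0 x + t • v) p := by
    intro t p
    change Polynomial.eval t ((finSuccEquiv ℝ 2 (sh w hw0 p)).map (eval x)) = _
    rw [← eval_eq_eval_mv_eval', eval_sh]
    congr 2
    ext i
    refine Fin.cases ?_ (fun j => ?_) i
    · simp [hw, hv0]
    · simp [hw]
  have hz : ∃ t : ℝ, eval (Fin.cons 0 x + t • v : Fin 3 → ℝ) c = 0 := by
    set y : Fin 3 → ℝ := Fin.cons 0 x with hy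
    let F : ℝ → ℝ := fun θ => eval (Real.cos θ • v + Real.sin θ • y) c
    have hF : Continuous F := by
      apply (MvPolynomial.continuous_eval c).comp
      fun_prop
    have h0 : F 0 = eval v c := by simp [F]
    have hp : F Real.pi = - eval v c := by
      have := hom_eval hc (-1) v
      simp only [F, Real.cos_pi, Real.sin_pi, zero_smul, add_zero, this]
      ring
    have : ∃ θ, F θ = 0 := by
      have h1 : (0:ℝ) ∈ Set.uIcc (F 0) (F Real.pi) := by
        rw [h0, hp, Set.mem_uIcc]
        rcases le_total 0 (eval v c) with h | h
        · right; constructor <;> linarith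
        · left; constructor <;> linarith
      obtain ⟨θ, -, hθ⟩ := intermediate_value_uIcc hF.continuousOn h1
      exact ⟨θ, hθ⟩
    obtain ⟨θ, hθ⟩ := this
    have hs : Real.sin θ ≠ 0 := by
      intro hs
      have hcs := Real.sin_sq_add_cos_sq θ
      simp only [F, hs, zero_smul, add_zero, hom_eval hc, mul_eq_zero, hv, or_false] at hθ
      have : Real.cos θ = 0 := by simpa using hθ
      rw [hs, this] at hcs; norm_num at hcs
    refine ⟨(Real.sin θ)⁻¹ * Real.cos θ, ?_⟩
    have : y + ((Real.sin θ)⁻¹ * Real.cos θ) • v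
        = (Real.sin θ)⁻¹ • (Real.cos θ • v + Real.sin θ • y) := by
      ext i; simp; field_simp; ring
    rw [this, hom_eval hc]
    simp only [F] at hθ
    rw [hθ, mul_zero]
  obtain ⟨t, ht⟩ := hz
  have hd := hcon _ ht
  have := congrArg (fun p => Polynomial.eval t (p.map (eval x))) hab
  simp only [Polynomial.map_add, Polynomial.map_mul, Polynomial.eval_add, Polynomial.eval_mul, key,
    ht, hd, Polynomial.map_C, Polynomial.eval_C, mul_zero, add_zero] at this
  exact hx this.symm

theorem mem_Isub {d : ℕ} {T : Set P2} {f : MvPolynomial (Fin 3) ℝ} :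
    f ∈ Isub d T ↔ f.IsHomogeneous d ∧ ∀ P ∈ T, VanishAt f P := Iff.rfl

instance Isub_fin (d : ℕ) (T : Set P2) : FiniteDimensional ℝ (Isub d T) := by
  have : FiniteDimensional ℝ (homogeneousSubmodule (Fin 3) ℝ d) :=
    Module.Finite.iff_fg.2 (homogeneousSubmodule_fg _ _ d)
  exact Submodule.finiteDimensional_of_le (S₂ := homogeneousSubmodule (Fin 3) ℝ d) inf_le_left

theorem vanishAt_mk {f : MvPolynomial (Fin 3) ℝ} {n : ℕ} (hf : f.IsHomogeneous n)
    {w : Fin 3 → ℝ} (hw : w ≠ 0) (h : eval w f = 0) : VanishAt f (Projectivization.mk ℝ w hw) := by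
  obtain ⟨a, ha⟩ := Projectivization.exists_smul_eq_mk_rep ℝ w hw
  unfold VanishAt
  rw [← ha, Units.smul_def, hom_eval hf, h, mul_zero]

theorem lin_form {l : MvPolynomial (Fin 3) ℝ} (hl : l.IsHomogeneous 1) :
    ∃ v : Fin 3 → ℝ, l = ∑ i, X i * C (v i) := by
  have h := hl.sum_X_mul_pderiv
  have h2 : ∀ i, ∃ k, pderiv i l = C k := by
    intro i
    have : (pderiv i l).IsHomogeneous 0 := hl.pderiv
    exact ⟨_, (totalDegree_eq_zero_iff_eq_C.1 (Nat.le_zero.1 this.totalDegree_le))⟩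
  choose v hv using h2
  refine ⟨v, ?_⟩
  simp only [hv] at h
  rw [h]; simp

theorem ker_dep {v a b c : Fin 3 → ℝ} (hv : v ≠ 0) (ha : ∑ i, a i * v i = 0)
    (hb : ∑ i, b i * v i = 0) (hc : ∑ i, c i * v i = 0) :
    ∃ α β γ : ℝ, (α ≠ 0 ∨ β ≠ 0 ∨ γ ≠ 0) ∧ α • a + β • b + γ • c = 0 := by
  have hdet : (Matrix.of ![a, b, c]).det = 0 := by
    rw [← Matrix.exists_mulVec_eq_zero_iff]
    refine ⟨v, hv, ?_⟩
    ext i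
    fin_cases i <;> simpa [Matrix.mulVec, dotProduct] using ‹_›
  obtain ⟨k, hk, hk2⟩ := Matrix.exists_vecMul_eq_zero_iff.2 hdet
  refine ⟨k 0, k 1, k 2, ?_, ?_⟩
  · by_contra! h
    apply hk
    ext i; fin_cases i <;> simp [h]
  · ext i
    have := congrFun hk2 i
    simpa [Matrix.vecMul, dotProduct, Fin.sum_univ_three] using this

theorem eq_of_prop {P Q : P2} {x : Fin 3 → ℝ} {a b : ℝ} (hP : P.rep = a • x) (hQ : Q.rep = b • x) :
    P = Q := by
  have hb : b ≠ 0 := by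
    rintro rfl
    exact Q.rep_nonzero (by simpa using hQ)
  rw [← P.mk_rep, ← Q.mk_rep, Projectivization.mk_eq_mk_iff']
  refine ⟨a * b⁻¹, ?_⟩
  rw [hP, hQ, smul_smul]
  congr 1
  field_simp

theorem vanish_on_ker {f : MvPolynomial (Fin 3) ℝ} {n : ℕ} (hf : f.IsHomogeneous n)
    {v : Fin 3 → ℝ} (hv : v ≠ 0) (S : Finset P2) (hS : n < S.card)
    (hSv : ∀ P ∈ S, ∑ i, P.rep i * v i = 0) (hSf : ∀ P ∈ S, VanishAt f P)
    (x : Fin 3 → ℝ) (hx : ∑ i, x i * v i = 0) : eval x f = 0 := by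
  by_cases hprop : ∃ P ∈ S, ∃ a : ℝ, x = a • P.rep
  · obtain ⟨P, hP, a, rfl⟩ := hprop
    rw [hom_eval hf, hSf P hP, mul_zero]
  push Not at hprop
  obtain ⟨P0, hP0⟩ : S.Nonempty := Finset.card_pos.1 (by omega)
  set p := P0.rep with hp
  have hroot : ∀ P ∈ S, ∃ t b : ℝ, P.rep = b • (p + t • x) := by
    intro P hP
    obtain ⟨α, β, γ, hne, h0⟩ := ker_dep hv hx (hSv P0 hP0) (hSv P hP)
    have hγ : γ ≠ 0 := by
      rintro rfl
      have hα : α = 0 := by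
        by_contra hα
        apply hprop P0 hP0 (-(α⁻¹ * β))
        ext i
        have := congrFun h0 i
        simp at this ⊢
        field_simp
        linarith
      subst hα
      have hβ : β ≠ 0 := by simpa using hne
      apply P0.rep_nonzero
      simpa [hβ] using h0
    by_cases hβ : β = 0
    · exfalso
      subst hβ
      have hα : α ≠ 0 := by
        rintro rfl
        apply P.rep_nonzero
        simpa [hγ] using h0
      apply hprop P hP (-(α⁻¹ * γ))
      ext i
      have := congrFun h0 i
      simp at this ⊢
      field_simp
      linarith
    · refine ⟨α / β, -(β / γ), ?_⟩
      ext i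
      have := congrFun h0 i
      simp at this ⊢
      field_simp
      linarith
  choose! t b ht using hroot
  let q : Polynomial ℝ := aeval (fun i => Polynomial.C (p i) + Polynomial.X * Polynomial.C (x i)) f
  have hq : ∀ s, q.eval s = eval (p + s • x) f := by
    intro s
    change (Polynomial.evalRingHom s) (aeval _ f) = _
    have : (Polynomial.evalRingHom s : Polynomial ℝ →+* ℝ) =
      (Polynomial.aeval s : Polynomial ℝ →ₐ[ℝ] ℝ) := by ext <;> simp
    rw [this]
    change (Polynomial.aeval s) (aeval _ f) = _
    rw [comp_aeval_apply, ← aeval_eq_eval]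
    congr 2
    ext i
    simp; ring
  have hdeg : q.natDegree ≤ n := by
    have := MvPolynomial.aeval_natDegree_le f hf.totalDegree_le
      (fun i => Polynomial.C (p i) + Polynomial.X * Polynomial.C (x i)) (n := 1) (by
        intro i
        compute_degree)
    rwa [mul_one] at this
  have hq0 : q = 0 := by
    refine Polynomial.eq_zero_of_natDegree_lt_card_of_eval_eq_zero q (ι := S)
      (f := fun P => t P.1) ?_ ?_ (by simpa using lt_of_le_of_lt hdeg hS)
    · rintro ⟨P, hP⟩ ⟨Q, hQ⟩ h
      have h1 := ht P hP
      have h2 := ht Q hQ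
      simp only at h
      rw [h] at h1
      exact Subtype.ext (eq_of_prop h1 h2)
    · rintro ⟨P, hP⟩
      rw [hq]
      have h1 := ht P hP
      have h2 := hSf P hP
      unfold VanishAt at h2
      rw [h1, hom_eval hf, mul_eq_zero] at h2
      rcases h2 with h2 | h2
      · exfalso
        have : b P = 0 := eq_zero_of_pow_eq_zero h2
        rw [this] at h1
        exact P.rep_nonzero (by simpa using h1)
      · exact h2
  have hall : ∀ s, eval (p + s • x) f = 0 := fun s => by rw [← hq, hq0]; simp
  have hcont : Continuous fun s : ℝ => eval (x + s • p) f := by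
    apply (MvPolynomial.continuous_eval f).comp
    fun_prop
  have h2 : (fun s : ℝ => eval (x + s • p) f) = fun _ => 0 := by
    apply Continuous.ext_on (dense_compl_singleton (0:ℝ)) hcont continuous_const
    intro s hs
    have hs : s ≠ 0 := hs
    have : x + s • p = s • (p + s⁻¹ • x) := by
      rw [smul_add, smul_smul, mul_inv_cancel₀ hs, one_smul, add_comm]
    simp only
    rw [this, hom_eval hf, hall, mul_zero]
  have := congrFun h2 0
  simpa using this

theorem eval_lin (v x : Fin 3 → ℝ) :
    eval x (∑ i, X i * C (v i) : MvPolynomial (Fin 3) ℝ) = ∑ i, x i * v i := by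
  simp

theorem lin_dvd {f l : MvPolynomial (Fin 3) ℝ} (hl0 : l ≠ 0) (hl : l.IsHomogeneous 1)
    (h : ∀ x, eval x l = 0 → eval x f = 0) : l ∣ f := by
  obtain ⟨v, rfl⟩ := lin_form hl
  set l : MvPolynomial (Fin 3) ℝ := ∑ i, X i * C (v i) with hldef
  obtain ⟨u, hu⟩ := ex_eval_ne hl0
  let p : Fin 3 → ℝ := (eval u l)⁻¹ • u
  have hp : eval p l = 1 := by rw [hom_eval hl]; simp [hu]
  have h0 : aeval (fun i => X i - l * C (p i)) f = 0 := by
    apply MvPolynomial.funext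
    intro x
    rw [map_zero, ← aeval_eq_eval, comp_aeval_apply, aeval_eq_eval]
    apply h
    rw [eval_lin] at hp
    rw [eval_lin]
    simp only [map_sub, map_mul, aeval_eq_eval, eval_X, eval_C, sub_mul, Finset.sum_sub_distrib]
    rw [← eval_lin v x]
    have : ∑ i, eval x l * p i * v i = eval x l := by
      simp only [mul_assoc]
      rw [← Finset.mul_sum, hp, mul_one]
    rw [this, sub_self]
  rw [← Ideal.mem_span_singleton, ← Ideal.Quotient.eq_zero_iff_mem]
  have h1 := congrArg (Ideal.Quotient.mkₐ ℝ (Ideal.span {l})) h0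
  rw [comp_aeval_apply, map_zero] at h1
  have h2 : (fun i => (Ideal.Quotient.mkₐ ℝ (Ideal.span {l})) (X i - l * C (p i)))
      = fun i => (Ideal.Quotient.mkₐ ℝ (Ideal.span {l})) (X i) := by
    ext i
    rw [map_sub, map_mul]
    have : (Ideal.Quotient.mkₐ ℝ (Ideal.span {l})) l = 0 :=
      Ideal.Quotient.eq_zero_iff_mem.2 (Ideal.mem_span_singleton_self l)
    rw [this]; simp
  rw [h2, ← comp_aeval_apply] at h1
  simpa using h1

open Classical in
theorem castel {d : ℕ} (e : ℕ) (he : e = d + 1) {l : MvPolynomial (Fin 3) ℝ} (hl0 : l ≠ 0) (hl : l.IsHomogeneous 1)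
    (S : Finset P2) (hS : e < (S.filter (VanishAt l)).card) :
    Module.finrank ℝ (Isub e (S : Set P2)) ≤
      Module.finrank ℝ (Isub d ((S.filter (fun P => ¬ VanishAt l P) : Finset P2) : Set P2)) := by
  subst he
  have hle : Isub (d + 1) (S : Set P2) ≤
      (Isub d ((S.filter (fun P => ¬ VanishAt l P) : Finset P2) : Set P2)).map
        (LinearMap.mulLeft ℝ l) := by
    intro f hf
    obtain ⟨hf1, hf2⟩ := mem_Isub.1 hf
    have hdvd : l ∣ f := by
      apply lin_dvd hl0 hl
      obtain ⟨v, rfl⟩ := lin_form hl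
      have hv : v ≠ 0 := by rintro rfl; simp at hl0
      intro x hx
      rw [eval_lin] at hx
      refine vanish_on_ker hf1 hv _ hS ?_ ?_ x hx
      · intro P hP
        have := (Finset.mem_filter.1 hP).2
        unfold VanishAt at this
        rwa [eval_lin] at this
      · intro P hP
        exact hf2 P (Finset.mem_coe.2 (Finset.mem_filter.1 hP).1)
    obtain ⟨k, hk⟩ := hdvd
    refine ⟨k, mem_Isub.2 ⟨hom_right (by rwa [add_comm]) hl hl0 hk, ?_⟩, hk.symm⟩
    intro P hP
    obtain ⟨hP1, hP2⟩ := Finset.mem_filter.1 (Finset.mem_coe.1 hP)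
    have := hf2 P (Finset.mem_coe.2 hP1)
    unfold VanishAt at *
    rw [hk, map_mul, mul_eq_zero] at this
    exact this.resolve_left hP2
  exact (Submodule.finrank_mono hle).trans (Submodule.finrank_map_le _ _)

open Classical in
theorem finrank_insert (d : ℕ) (S : Finset P2) (Q : P2) :
    Module.finrank ℝ (Isub d (S : Set P2)) ≤
      Module.finrank ℝ (Isub d ((insert Q S : Finset P2) : Set P2)) + 1 := by
  let φ : MvPolynomial (Fin 3) ℝ →ₗ[ℝ] ℝ := (aeval Q.rep).toLinearMap
  have hφ : ∀ f, φ f = eval Q.rep f := fun f => by simp [φ, aeval_eq_eval]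
  let W := Isub d (S : Set P2)
  have h := (φ.domRestrict W).finrank_range_add_finrank_ker
  have h1 : Module.finrank ℝ (LinearMap.range (φ.domRestrict W)) ≤ 1 := by
    have := Submodule.finrank_le (LinearMap.range (φ.domRestrict W))
    simpa using this
  have h2 : Module.finrank ℝ (LinearMap.ker (φ.domRestrict W)) ≤
      Module.finrank ℝ (Isub d ((insert Q S : Finset P2) : Set P2)) := by
    rw [← Submodule.finrank_map_subtype_eq W (LinearMap.ker (φ.domRestrict W))]
    apply Submodule.finrank_mono
    rintro _ ⟨⟨f, hf⟩, hk, rfl⟩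
    obtain ⟨hf1, hf2⟩ := mem_Isub.1 hf
    refine mem_Isub.2 ⟨hf1, ?_⟩
    intro P hP
    rw [Finset.coe_insert] at hP
    rcases hP with rfl | hP
    · have : φ f = 0 := hk
      rwa [hφ] at this
    · exact hf2 P hP
  change Module.finrank ℝ W ≤ _
  omega

theorem exists_line (P Q : P2) : ∃ l : MvPolynomial (Fin 3) ℝ, l ≠ 0 ∧ l.IsHomogeneous 1 ∧
    VanishAt l P ∧ VanishAt l Q := by
  have hdet : (Matrix.of ![P.rep, Q.rep, 0]).det = 0 :=
    Matrix.det_eq_zero_of_row_eq_zero 2 (by intro j; simp)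
  obtain ⟨v, hv, hv2⟩ := Matrix.exists_mulVec_eq_zero_iff.2 hdet
  refine ⟨∑ i, X i * C (v i), ?_, ?_, ?_, ?_⟩
  · intro h
    apply hv
    ext i
    have := congrArg (eval (Pi.single i 1)) h
    rw [eval_lin] at this
    simpa [Pi.single_apply] using this
  · apply IsHomogeneous.sum
    intro i _
    exact (isHomogeneous_X _ _).mul (isHomogeneous_C _ _)
  · unfold VanishAt; rw [eval_lin]
    simpa [Matrix.mulVec, dotProduct] using congrFun hv2 0
  · unfold VanishAt; rw [eval_lin]
    simpa [Matrix.mulVec, dotProduct] using congrFun hv2 1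

theorem exists_new {l : MvPolynomial (Fin 3) ℝ} (hl : l.IsHomogeneous 1) {P Q : P2} (hPQ : P ≠ Q)
    (hP : VanishAt l P) (hQ : VanishAt l Q) (S : Finset P2) : ∃ R, R ∉ S ∧ VanishAt l R := by
  have hne : ∀ t : ℝ, P.rep + t • Q.rep ≠ 0 := by
    intro t ht
    apply hPQ
    apply eq_of_prop (x := Q.rep) (a := -t) (b := 1) _ (by simp)
    rw [neg_smul]; exact eq_neg_of_add_eq_zero_left ht
  let φ : ℝ → P2 := fun t => Projectivization.mk ℝ _ (hne t)
  have hφ : Function.Injective φ := by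
    intro s t h
    obtain ⟨a, ha⟩ := (Projectivization.mk_eq_mk_iff' ℝ _ _ _ _).1 h
    have h1 : (a - 1) • P.rep = (s - a * t) • Q.rep := by
      ext i
      have := congrFun ha i
      simp at this ⊢
      linarith
    have ha1 : a = 1 := by
      by_contra hne1
      apply hPQ
      apply eq_of_prop (x := Q.rep) (a := (a-1)⁻¹ * (s - a * t)) (b := 1) _ (by simp)
      rw [mul_smul, ← h1, smul_smul, inv_mul_cancel₀ (sub_ne_zero.2 hne1), one_smul]
    subst ha1
    have := Q.rep_nonzero
    rw [sub_self, zero_smul, eq_comm, smul_eq_zero, one_mul] at h1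
    exact sub_eq_zero.1 (h1.resolve_right this)
  obtain ⟨R, ⟨t, rfl⟩, hR⟩ := (Set.infinite_range_of_injective hφ).exists_notMem_finset S
  refine ⟨φ t, hR, vanishAt_mk hl _ ?_⟩
  obtain ⟨v, rfl⟩ := lin_form hl
  unfold VanishAt at hP hQ
  rw [eval_lin] at *
  simp only [Pi.add_apply, Pi.smul_apply, smul_eq_mul, add_mul, mul_assoc, Finset.sum_add_distrib]
  rw [← Finset.mul_sum, hP, hQ]; simp

theorem Isub_zero_le (S : Set P2) : Module.finrank ℝ (Isub 0 S) ≤ 1 := by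
  have hle : Isub 0 S ≤ Submodule.span ℝ {(1 : MvPolynomial (Fin 3) ℝ)} := by
    intro f hf
    have h := totalDegree_eq_zero_iff_eq_C.1 (Nat.le_zero.1 (mem_Isub.1 hf).1.totalDegree_le)
    rw [Submodule.mem_span_singleton]
    refine ⟨coeff 0 f, ?_⟩
    conv_rhs => rw [h]
    rw [smul_eq_C_mul, mul_one]
  refine (Submodule.finrank_mono hle).trans ?_
  simpa using finrank_span_le_card (R := ℝ) ({(1 : MvPolynomial (Fin 3) ℝ)} : Set _)

theorem Isub_one_le (S : Finset P2) (hS : 2 ≤ S.card) :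
    Module.finrank ℝ (Isub 1 (S : Set P2)) ≤ 1 := by
  classical
  obtain ⟨P, hP, Q, hQ, hPQ⟩ := Finset.one_lt_card.1 (show 1 < S.card by omega)
  obtain ⟨l, hl0, hl, h1, h2⟩ := exists_line P Q
  refine (castel (d := 0) 1 rfl hl0 hl S ?_).trans (Isub_zero_le _)
  exact Finset.one_lt_card.2 ⟨P, by simp [hP, h1], Q, by simp [hQ, h2], hPQ⟩

open Classical in
theorem conics_le (S : Finset P2) (hS : 5 ≤ S.card)
    (h3 : ∀ l : MvPolynomial (Fin 3) ℝ, l ≠ 0 → l.IsHomogeneous 1 →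
      (S.filter (VanishAt l)).card ≤ 3) :
    Module.finrank ℝ (Isub 2 (S : Set P2)) ≤ 1 := by
  by_cases hc : ∃ l : MvPolynomial (Fin 3) ℝ, l ≠ 0 ∧ l.IsHomogeneous 1 ∧
      2 < (S.filter (VanishAt l)).card
  · obtain ⟨l, hl0, hl, hc⟩ := hc
    refine (castel (d := 1) 2 rfl hl0 hl S hc).trans (Isub_one_le _ ?_)
    have := Finset.card_filter_add_card_filter_not (s := S) (VanishAt l)
    have := h3 l hl0 hl
    omega
  · push Not at hc
    obtain ⟨P, hP, Q, hQ, hPQ⟩ := Finset.one_lt_card.1 (show 1 < S.card by omega)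
    obtain ⟨l, hl0, hl, h1, h2⟩ := exists_line P Q
    obtain ⟨R, hR, hRl⟩ := exists_new hl hPQ h1 h2 S
    have hcard : 1 < (S.filter (VanishAt l)).card :=
      Finset.one_lt_card.2 ⟨P, by simp [hP, h1], Q, by simp [hQ, h2], hPQ⟩
    refine (finrank_insert 2 S R).trans ?_
    have := castel (d := 1) 2 rfl hl0 hl (insert R S) (by
      rw [Finset.filter_insert, if_pos hRl, Finset.card_insert_of_notMem (by simp [hR])]
      omega)
    rw [Finset.filter_insert, if_neg (not_not.2 hRl)] at this
    have h0 : Isub 1 ((S.filter (fun P => ¬ VanishAt l P) : Finset P2) : Set P2) = ⊥ := by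
      rw [Submodule.eq_bot_iff]
      intro m hm
      by_contra hm0
      obtain ⟨hm1, hm2⟩ := mem_Isub.1 hm
      have h4 := hc m hm0 hm1
      have h5 : S.filter (fun P => ¬ VanishAt l P) ⊆ S.filter (VanishAt m) := by
        intro P hP
        exact Finset.mem_filter.2 ⟨(Finset.mem_filter.1 hP).1, hm2 P (Finset.mem_coe.2 hP)⟩
      have h6 := Finset.card_le_card h5
      have := Finset.card_filter_add_card_filter_not (s := S) (VanishAt l)
      have := hc l hl0 hl
      omega
    rw [h0, finrank_bot] at this
    omega

theorem prop_of_finrank {W : Submodule ℝ (MvPolynomial (Fin 3) ℝ)} [FiniteDimensional ℝ W]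
    (h : Module.finrank ℝ W ≤ 1) {a b : MvPolynomial (Fin 3) ℝ} (ha : a ∈ W) (hb : b ∈ W)
    (ha0 : a ≠ 0) : ∃ μ : ℝ, b = μ • a := by
  obtain ⟨v, hv⟩ := finrank_le_one_iff.1 h
  obtain ⟨α, hα⟩ := hv ⟨a, ha⟩
  obtain ⟨β, hβ⟩ := hv ⟨b, hb⟩
  have h1 : α • (v : MvPolynomial (Fin 3) ℝ) = a := congrArg Subtype.val hα
  have h2 : β • (v : MvPolynomial (Fin 3) ℝ) = b := congrArg Subtype.val hβ
  have : α ≠ 0 := by rintro rfl; apply ha0; rw [← h1, zero_smul]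
  refine ⟨β * α⁻¹, ?_⟩
  rw [← h1, ← h2, smul_smul, mul_assoc, inv_mul_cancel₀ this, mul_one]

open Classical in
theorem cubics_le (S : Finset P2) (hS : S.card = 8)
    (h3 : ∀ l : MvPolynomial (Fin 3) ℝ, l ≠ 0 → l.IsHomogeneous 1 →
      (S.filter (VanishAt l)).card ≤ 3)
    (h6 : ∀ l : MvPolynomial (Fin 3) ℝ, l ≠ 0 → l.IsHomogeneous 2 →
      (S.filter (VanishAt l)).card ≤ 6) :
    Module.finrank ℝ (Isub 3 (S : Set P2)) ≤ 2 := by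
  have h3' : ∀ S' ⊆ S, ∀ l : MvPolynomial (Fin 3) ℝ, l ≠ 0 → l.IsHomogeneous 1 →
      (S'.filter (VanishAt l)).card ≤ 3 := fun S' hS' l hl0 hl =>
    (Finset.card_le_card (Finset.filter_subset_filter _ hS')).trans (h3 l hl0 hl)
  by_cases hc : ∃ l : MvPolynomial (Fin 3) ℝ, l ≠ 0 ∧ l.IsHomogeneous 1 ∧
      2 < (S.filter (VanishAt l)).card
  · obtain ⟨l, hl0, hl, hc⟩ := hc
    obtain ⟨P, hP, Q, hQ, hPQ⟩ := Finset.one_lt_card.1 (lt_trans one_lt_two hc)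
    obtain ⟨R, hR, hRl⟩ := exists_new hl hPQ (Finset.mem_filter.1 hP).2 (Finset.mem_filter.1 hQ).2 S
    refine (finrank_insert 3 S R).trans ?_
    have := castel (d := 2) 3 rfl hl0 hl (insert R S) (by
      rw [Finset.filter_insert, if_pos hRl, Finset.card_insert_of_notMem (by simp [hR])]
      omega)
    rw [Finset.filter_insert, if_neg (not_not.2 hRl)] at this
    have h5 := conics_le (S.filter (fun P => ¬ VanishAt l P)) (by
      have := Finset.card_filter_add_card_filter_not (s := S) (VanishAt l)
      have := h3 l hl0 hl
      omega) (h3' _ (Finset.filter_subset _ _))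
    omega
  · push Not at hc
    by_contra hcon
    have key : ∀ P ∈ S, ∀ Q ∈ S, P ≠ Q → ∃ c : MvPolynomial (Fin 3) ℝ, c ≠ 0 ∧
        c ∈ Isub 2 ((S \ {P, Q} : Finset P2) : Set P2) := by
      intro P hP Q hQ hPQ
      obtain ⟨l, hl0, hl, h1, h2⟩ := exists_line P Q
      obtain ⟨R, hR, hRl⟩ := exists_new hl hPQ h1 h2 S
      obtain ⟨R', hR', hRl'⟩ := exists_new hl hPQ h1 h2 (insert R S)
      have i1 := finrank_insert 3 S R
      have i2 := finrank_insert 3 (insert R S) R'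
      have hcard : 1 < (S.filter (VanishAt l)).card :=
        Finset.one_lt_card.2 ⟨P, by simp [hP, h1], Q, by simp [hQ, h2], hPQ⟩
      have i3 := castel (d := 2) 3 rfl hl0 hl (insert R' (insert R S)) (by
        rw [Finset.filter_insert, if_pos hRl', Finset.card_insert_of_notMem (by
          intro h; exact hR' (Finset.mem_filter.1 h).1),
          Finset.filter_insert, if_pos hRl, Finset.card_insert_of_notMem (by simp [hR])]
        omega)
      rw [Finset.filter_insert, if_neg (not_not.2 hRl'),
        Finset.filter_insert, if_neg (not_not.2 hRl)] at i3
      have hpos : 0 < Module.finrank ℝ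
          (Isub 2 ((S.filter (fun P => ¬ VanishAt l P) : Finset P2) : Set P2)) := by omega
      have hne : Isub 2 ((S.filter (fun P => ¬ VanishAt l P) : Finset P2) : Set P2) ≠ ⊥ := by
        intro h
        rw [h, finrank_bot] at hpos
        omega
      obtain ⟨c, hc1, hc0⟩ := Submodule.exists_mem_ne_zero_of_ne_bot hne
      refine ⟨c, hc0, mem_Isub.2 ⟨(mem_Isub.1 hc1).1, ?_⟩⟩
      intro X hX
      have hX := Finset.mem_coe.1 hX
      rw [Finset.mem_sdiff] at hX
      apply (mem_Isub.1 hc1).2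
      rw [Finset.mem_coe, Finset.mem_filter]
      refine ⟨hX.1, fun hXl => ?_⟩
      simp only [Finset.mem_insert, Finset.mem_singleton, not_or] at hX
      have : ({X, P, Q} : Finset P2) ⊆ S.filter (VanishAt l) := by
        intro Y hY
        simp only [Finset.mem_insert, Finset.mem_singleton] at hY
        rcases hY with rfl | rfl | rfl <;> simp [*]
      have h7 := Finset.card_le_card this
      rw [Finset.card_eq_three.2 ⟨X, P, Q, hX.2.1, hX.2.2, hPQ, rfl⟩] at h7
      have := hc l hl0 hl
      omega
    obtain ⟨P, hP, Q, hQ, R, hR, hPQ, hPR, hQR⟩ := Finset.two_lt_card.1 (show 2 < S.card by omega)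
    obtain ⟨c, hc0, hc1⟩ := key P hP Q hQ hPQ
    obtain ⟨c', hc0', hc1'⟩ := key P hP R hR hPR
    have hsub : S \ {P, Q, R} ⊆ S := Finset.sdiff_subset
    have hcd : (S \ {P, Q, R}).card = 5 := by
      rw [Finset.card_sdiff_of_subset, Finset.card_eq_three.2 ⟨P, Q, R, hPQ, hPR, hQR, rfl⟩, hS]
      intro Y hY
      simp only [Finset.mem_insert, Finset.mem_singleton] at hY
      rcases hY with rfl | rfl | rfl <;> assumption
    obtain ⟨hh, hv⟩ := mem_Isub.1 hc1
    obtain ⟨hh', hv'⟩ := mem_Isub.1 hc1'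
    obtain ⟨μ, hμ⟩ := prop_of_finrank (conics_le _ hcd.ge (h3' _ hsub))
      (a := c') (b := c)
      (mem_Isub.2 ⟨hh', fun X hX => hv' X (by
        simp only [Finset.coe_sdiff, Finset.coe_insert, Finset.coe_singleton, Set.mem_sdiff,
          Set.mem_insert_iff, Set.mem_singleton_iff] at hX ⊢; tauto)⟩)
      (mem_Isub.2 ⟨hh, fun X hX => hv X (by
        simp only [Finset.coe_sdiff, Finset.coe_insert, Finset.coe_singleton, Set.mem_sdiff,
          Set.mem_insert_iff, Set.mem_singleton_iff] at hX ⊢; tauto)⟩) hc0'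
    have hbig : S.erase P ⊆ S.filter (VanishAt c) := by
      intro X hX
      obtain ⟨hXP, hXS⟩ := Finset.mem_erase.1 hX
      refine Finset.mem_filter.2 ⟨hXS, ?_⟩
      by_cases hXQ : X = Q
      · have := hv' X (by simp [hXQ, hQR, hPQ.symm, hQ])
        unfold VanishAt at *
        rw [hμ, smul_eq_C_mul, map_mul, this, mul_zero]
      · exact hv X (by simp [hXP, hXS, hXQ])
    have h7 := Finset.card_le_card hbig
    rw [Finset.card_erase_of_mem hP] at h7
    have := h6 c hc0 hh
    omega

open Classical in
theorem relPrime_of_indep (S : Finset P2) (hS : S.card = 8)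
    (h3 : ∀ l : MvPolynomial (Fin 3) ℝ, l ≠ 0 → l.IsHomogeneous 1 →
      (S.filter (VanishAt l)).card ≤ 3)
    (h6 : ∀ l : MvPolynomial (Fin 3) ℝ, l ≠ 0 → l.IsHomogeneous 2 →
      (S.filter (VanishAt l)).card ≤ 6)
    {c d : MvPolynomial (Fin 3) ℝ} (hc : c ∈ Isub 3 (S : Set P2)) (hd : d ∈ Isub 3 (S : Set P2))
    (hc0 : c ≠ 0) (hne : ∀ μ : ℝ, d ≠ μ • c) : IsRelPrime c d := by
  rintro h ⟨a, ha⟩ ⟨b, hb⟩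
  by_contra hu
  obtain ⟨hc1, hc2⟩ := mem_Isub.1 hc
  obtain ⟨hd1, hd2⟩ := mem_Isub.1 hd
  obtain ⟨m, hm⟩ := hom_factor hc1 hc0 ha
  obtain ⟨n, hn⟩ := hom_factor hc1 hc0 (ha.trans (mul_comm _ _))
  have hh0 : h ≠ 0 := by rintro rfl; apply hc0; rw [ha, zero_mul]
  have ha0 : a ≠ 0 := by rintro rfl; apply hc0; rw [ha, mul_zero]
  have hmn : 3 = m + n := hc1.inj_right (ha ▸ hm.mul hn) hc0
  have hbn : b.IsHomogeneous n := hom_right (hmn ▸ hd1) hm hh0 hb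
  have hm0 : m ≠ 0 := by
    rintro rfl
    apply hu
    have h1 := totalDegree_eq_zero_iff_eq_C.1 (Nat.le_zero.1 hm.totalDegree_le)
    rw [h1]
    apply IsUnit.map
    rw [isUnit_iff_ne_zero]
    intro h2
    rw [h2, C_0] at h1
    exact hh0 h1
  set S' := S.filter (fun P => ¬ VanishAt h P) with hS'
  have hmem : ∀ x : MvPolynomial (Fin 3) ℝ, x.IsHomogeneous n →
      (∀ P ∈ (S : Set P2), VanishAt (h * x) P) → x ∈ Isub n (S' : Set P2) := by
    intro x hx hx2
    refine mem_Isub.2 ⟨hx, fun P hP => ?_⟩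
    obtain ⟨hP1, hP2⟩ := Finset.mem_filter.1 (Finset.mem_coe.1 hP)
    have := hx2 P (Finset.mem_coe.2 hP1)
    unfold VanishAt at *
    rw [map_mul, mul_eq_zero] at this
    exact this.resolve_left hP2
  have haI := hmem a hn (ha ▸ hc2)
  have hbI := hmem b hbn (hb ▸ hd2)
  have hcd := Finset.card_filter_add_card_filter_not (s := S) (VanishAt h)
  rw [← hS'] at hcd
  have hfin : Module.finrank ℝ (Isub n (S' : Set P2)) ≤ 1 := by
    have : m = 1 ∨ m = 2 ∨ m = 3 := by omega
    rcases this with rfl | rfl | rfl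
    · obtain rfl : n = 2 := by omega
      have := h3 h hh0 hm
      apply conics_le _ (by omega)
      intro l hl0 hl
      exact (Finset.card_le_card (Finset.filter_subset_filter _ (Finset.filter_subset _ _))).trans
        (h3 l hl0 hl)
    · obtain rfl : n = 1 := by omega
      have := h6 h hh0 hm
      exact Isub_one_le _ (by omega)
    · obtain rfl : n = 0 := by omega
      exact Isub_zero_le _
  obtain ⟨μ, hμ⟩ := prop_of_finrank hfin haI hbI ha0
  apply hne μ
  rw [ha, hb, hμ, mul_smul_comm]

theorem exists_gens {W : Submodule ℝ (MvPolynomial (Fin 3) ℝ)} [FiniteDimensional ℝ W]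
    (h : Module.finrank ℝ W ≤ 2) : ∃ f₁ ∈ W, ∃ f₂ ∈ W, ∀ f ∈ W, ∃ a b : ℝ, f = a • f₁ + b • f₂ := by
  obtain ⟨n, hn⟩ : ∃ n, Module.finrank ℝ W = n := ⟨_, rfl⟩
  let B := Module.finBasisOfFinrankEq ℝ W hn
  have hB : ∀ f (hf : f ∈ W), f = ∑ i, B.repr ⟨f, hf⟩ i • (B i : MvPolynomial (Fin 3) ℝ) := by
    intro f hf
    have := congrArg Subtype.val (B.sum_repr ⟨f, hf⟩)
    simp only [AddSubmonoidClass.coe_finsetSum, Submodule.coe_smul] at this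
    exact this.symm
  have hn2 : n = 0 ∨ n = 1 ∨ n = 2 := by omega
  rcases hn2 with rfl | rfl | rfl
  · refine ⟨0, W.zero_mem, 0, W.zero_mem, fun f hf => ⟨0, 0, ?_⟩⟩
    rw [hB f hf]; simp
  · refine ⟨B 0, (B 0).2, 0, W.zero_mem, fun f hf => ⟨B.repr ⟨f, hf⟩ 0, 0, ?_⟩⟩
    conv_lhs => rw [hB f hf]
    simp
  · refine ⟨B 0, (B 0).2, B 1, (B 1).2, fun f hf => ⟨B.repr ⟨f, hf⟩ 0, B.repr ⟨f, hf⟩ 1, ?_⟩⟩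
    conv_lhs => rw [hB f hf]
    rw [Fin.sum_univ_two]

theorem Isq_form {W : Submodule ℝ (MvPolynomial (Fin 3) ℝ)} {f₁ f₂ g : MvPolynomial (Fin 3) ℝ}
    (hf : ∀ f ∈ W, ∃ a b : ℝ, f = a • f₁ + b • f₂)
    (hg : g ∈ Submodule.span ℝ {h | ∃ f₁ ∈ W, ∃ f₂ ∈ W, h = f₁ * f₂}) :
    ∃ a b c : ℝ, g = C a * f₁ ^ 2 + C b * (f₁ * f₂) + C c * f₂ ^ 2 := by
  induction hg using Submodule.span_induction with
  | mem x hx =>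
    obtain ⟨p, hp, q, hq, rfl⟩ := hx
    obtain ⟨a, b, rfl⟩ := hf p hp
    obtain ⟨a', b', rfl⟩ := hf q hq
    refine ⟨a * a', a * b' + b * a', b * b', ?_⟩
    simp only [smul_eq_C_mul, C_mul, C_add]
    ring
  | zero => exact ⟨0, 0, 0, by simp⟩
  | add x y _ _ hx hy =>
    obtain ⟨a, b, c, rfl⟩ := hx
    obtain ⟨a', b', c', rfl⟩ := hy
    refine ⟨a + a', b + b', c + c', ?_⟩
    simp only [C_add]; ring
  | smul k x _ hx =>
    obtain ⟨a, b, c, rfl⟩ := hx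
    refine ⟨k * a, k * b, k * c, ?_⟩
    simp only [smul_eq_C_mul, C_mul]; ring

theorem sq_case {W : Submodule ℝ (MvPolynomial (Fin 3) ℝ)} {k : MvPolynomial (Fin 3) ℝ} {m : ℝ}
    (hk : k ∈ W) (hp : Psd (C m * k ^ 2)) :
    ∃ c₁ ∈ W, ∃ c₂ ∈ W, C m * k ^ 2 = c₁ ^ 2 + c₂ ^ 2 := by
  by_cases hm : 0 ≤ m
  · refine ⟨√m • k, W.smul_mem _ hk, 0, W.zero_mem, ?_⟩
    rw [smul_eq_C_mul, mul_pow, ← C_pow, Real.sq_sqrt hm]; simp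
  · have : k = 0 := by
      by_contra hk0
      obtain ⟨u, hu⟩ := ex_eval_ne hk0
      have := hp u
      simp only [map_mul, eval_C, map_pow] at this
      have := sq_pos_of_ne_zero hu
      nlinarith
    exact ⟨0, W.zero_mem, 0, W.zero_mem, by simp [this]⟩

theorem quad_case {W : Submodule ℝ (MvPolynomial (Fin 3) ℝ)} {f₁ f₂ : MvPolynomial (Fin 3) ℝ}
    {a b c : ℝ} (h1 : f₁ ∈ W) (h2 : f₂ ∈ W)
    (hq : ∀ s t : ℝ, 0 ≤ a * s ^ 2 + b * (s * t) + c * t ^ 2) :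
    ∃ c₁ ∈ W, ∃ c₂ ∈ W, C a * f₁ ^ 2 + C b * (f₁ * f₂) + C c * f₂ ^ 2 = c₁ ^ 2 + c₂ ^ 2 := by
  have ha : 0 ≤ a := by simpa using hq 1 0
  have hc : 0 ≤ c := by simpa using hq 0 1
  rcases ha.eq_or_lt with ha0 | ha0
  · have hb : b = 0 := by
      have e1 := hq (-(b * (c + 1))) (b^2)
      have e2 := hq (-(c + 1)) b
      subst ha0
      by_contra hb
      have : 0 < b ^ 2 := by positivity
      nlinarith
    refine ⟨0, W.zero_mem, √c • f₂, W.smul_mem _ h2, ?_⟩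
    rw [smul_eq_C_mul, mul_pow, ← C_pow, Real.sq_sqrt hc, ← ha0, hb]; simp
  · have hD : 0 ≤ c - b ^ 2 / (4 * a) := by
      have := hq (-(b / (2 * a))) 1
      have e : a * (-(b / (2 * a))) ^ 2 + b * (-(b / (2 * a)) * 1) + c * 1 ^ 2
        = c - b ^ 2 / (4 * a) := by field_simp; ring
      rwa [e] at this
    refine ⟨√a • (f₁ + (b / (2 * a)) • f₂), W.smul_mem _ (W.add_mem h1 (W.smul_mem _ h2)),
      √(c - b ^ 2 / (4 * a)) • f₂, W.smul_mem _ h2, ?_⟩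
    simp only [smul_eq_C_mul, mul_pow, ← C_pow, Real.sq_sqrt hD, Real.sq_sqrt ha0.le]
    have e1 : (C b : MvPolynomial (Fin 3) ℝ) = 2 * C a * C (b / (2 * a)) := by
      rw [show (2 : MvPolynomial (Fin 3) ℝ) = C 2 from rfl, ← C_mul, ← C_mul]
      congr 1; field_simp
    have e2 : (C c : MvPolynomial (Fin 3) ℝ) = C a * C (b / (2 * a)) ^ 2 + C (c - b ^ 2 / (4 * a)) := by
      rw [← C_pow, ← C_mul, ← C_add]
      congr 1; field_simp; ring
    linear_combination (f₁ * f₂) * e1 + f₂ ^ 2 * e2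

theorem psd_two_sq (T : Set P2) (hT8 : T.encard = 8) (hgen : GenPos T)
    (g : MvPolynomial (Fin 3) ℝ) (hg : Psd g) (hgI : g ∈ IsqCubic T) :
    ∃ c₁ ∈ Isub 3 T, ∃ c₂ ∈ Isub 3 T, g = c₁ ^ 2 + c₂ ^ 2 := by
  classical
  have hfinite : T.Finite := Set.finite_of_encard_eq_coe (k := 8) (by simpa using hT8)
  obtain ⟨S, rfl⟩ := hfinite.exists_finset_coe
  have hS : S.card = 8 := by
    rw [Set.encard_coe_eq_coe_finsetCard] at hT8
    exact_mod_cast hT8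
  have hset : ∀ l : MvPolynomial (Fin 3) ℝ,
      {P ∈ (S : Set P2) | VanishAt l P}.encard = (S.filter (VanishAt l)).card := by
    intro l
    rw [← Set.encard_coe_eq_coe_finsetCard]
    congr 1
    ext P; simp
  have h3 : ∀ l : MvPolynomial (Fin 3) ℝ, l ≠ 0 → l.IsHomogeneous 1 →
      (S.filter (VanishAt l)).card ≤ 3 := by
    intro l hl0 hl
    have := hgen.1 l hl0 hl
    rw [hset] at this
    exact_mod_cast this
  have h6 : ∀ l : MvPolynomial (Fin 3) ℝ, l ≠ 0 → l.IsHomogeneous 2 →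
      (S.filter (VanishAt l)).card ≤ 6 := by
    intro l hl0 hl
    have := hgen.2 l hl0 hl
    rw [hset] at this
    exact_mod_cast this
  obtain ⟨f₁, hf1, f₂, hf2, hf⟩ := exists_gens (cubics_le S hS h3 h6)
  obtain ⟨α, β, γ, rfl⟩ := Isq_form hf hgI
  by_cases hq : ∀ s t : ℝ, 0 ≤ α * s ^ 2 + β * (s * t) + γ * t ^ 2
  · exact quad_case hf1 hf2 hq
  push Not at hq
  obtain ⟨s, t, hst⟩ := hq
  set N := s ^ 2 + t ^ 2 with hN
  have hN0 : N ≠ 0 := by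
    intro h
    have hs : s = 0 := by nlinarith [sq_nonneg s, sq_nonneg t]
    have ht : t = 0 := by nlinarith [sq_nonneg s, sq_nonneg t]
    subst hs ht
    simp at hst
  set c := t • f₁ - s • f₂ with hcdef
  set d := s • f₁ + t • f₂ with hddef
  have hcI : c ∈ Isub 3 (S : Set P2) :=
    Submodule.sub_mem _ (Submodule.smul_mem _ _ hf1) (Submodule.smul_mem _ _ hf2)
  have hdI : d ∈ Isub 3 (S : Set P2) :=
    Submodule.add_mem _ (Submodule.smul_mem _ _ hf1) (Submodule.smul_mem _ _ hf2)
  have hCN : (C N⁻¹ * (C s ^ 2 + C t ^ 2) : MvPolynomial (Fin 3) ℝ) = 1 := by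
    rw [← C_pow, ← C_pow, ← C_add, ← C_mul, ← hN, inv_mul_cancel₀ hN0, C_1]
  have e1 : f₁ = C N⁻¹ * (C t * c + C s * d) := by
    simp only [hcdef, hddef, smul_eq_C_mul]
    linear_combination (-f₁) * hCN
  have e2 : f₂ = C N⁻¹ * (C t * d - C s * c) := by
    simp only [hcdef, hddef, smul_eq_C_mul]
    linear_combination (-f₂) * hCN
  have multiple : ∀ (k : MvPolynomial (Fin 3) ℝ) (a b : ℝ), k ∈ Isub 3 (S : Set P2) →
      f₁ = C a * k → f₂ = C b * k → ∃ c₁ ∈ Isub 3 (S : Set P2), ∃ c₂ ∈ Isub 3 (S : Set P2),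
        C α * f₁ ^ 2 + C β * (f₁ * f₂) + C γ * f₂ ^ 2 = c₁ ^ 2 + c₂ ^ 2 := by
    intro k a b hk h1 h2
    have e : C α * f₁ ^ 2 + C β * (f₁ * f₂) + C γ * f₂ ^ 2 =
        C (α * a ^ 2 + β * (a * b) + γ * b ^ 2) * k ^ 2 := by
      rw [h1, h2]; simp only [C_add, C_mul, C_pow]; ring
    rw [e] at hg ⊢
    exact sq_case hk hg
  by_cases hc0 : c = 0
  · apply multiple d (N⁻¹ * s) (N⁻¹ * t) hdI
    · rw [hc0] at e1; rw [C_mul]; linear_combination e1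
    · rw [hc0] at e2; rw [C_mul]; linear_combination e2
  by_cases hμ : ∃ μ : ℝ, d = μ • c
  · obtain ⟨μ, hμ⟩ := hμ
    rw [hμ, smul_eq_C_mul] at e1 e2
    apply multiple c (N⁻¹ * (t + s * μ)) (N⁻¹ * (t * μ - s)) hcI
    · simp only [C_mul, C_add]; linear_combination e1
    · simp only [C_mul, C_sub]; linear_combination e2
  push Not at hμ
  exfalso
  obtain ⟨u, hu1, hu2⟩ := exists_zero_ne (mem_Isub.1 hcI).1 hc0
    (relPrime_of_indep S hS h3 h6 hcI hdI hc0 hμ)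
  have p1 := congrArg (eval u) e1
  have p2 := congrArg (eval u) e2
  simp only [map_mul, map_add, map_sub, eval_C, hu1, mul_zero, zero_add, sub_zero] at p1 p2
  have hgu := hg u
  simp only [map_mul, map_add, map_pow, eval_C] at hgu
  rw [p1, p2] at hgu
  have e : α * (N⁻¹ * (s * eval u d)) ^ 2 + β * (N⁻¹ * (s * eval u d) * (N⁻¹ * (t * eval u d))) +
      γ * (N⁻¹ * (t * eval u d)) ^ 2 =
      (N⁻¹ * eval u d) ^ 2 * (α * s ^ 2 + β * (s * t) + γ * t ^ 2) := by ring
  rw [e] at hgu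
  have : 0 < (N⁻¹ * eval u d) ^ 2 := sq_pos_of_ne_zero (mul_ne_zero (inv_ne_zero hN0) hu2)
  nlinarith

theorem statement4 (T : Set P2) (hT8 : T.encard = 8) (hgen : GenPos T) :
    (∀ g : MvPolynomial (Fin 3) ℝ, Psd g → g ∈ IsqCubic T →
      ∃ c₁ ∈ Isub 3 T, ∃ c₂ ∈ Isub 3 T, g = c₁ ^ 2 + c₂ ^ 2) ∧
    {g : MvPolynomial (Fin 3) ℝ | g.IsHomogeneous 6 ∧ Sos g ∧ ∀ P ∈ T, VanishAt g P} =
      {g : MvPolynomial (Fin 3) ℝ | Psd g ∧ g ∈ IsqCubic T} := by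
  refine ⟨fun g hg hgI => psd_two_sq T hT8 hgen g hg hgI, ?_⟩
  ext g
  simp only [Set.mem_ofPred_eq]
  constructor
  · rintro ⟨hg6, ⟨n, h, e⟩, hv⟩
    have hev : ∀ u, eval u g = ∑ i, (eval u (h i)) ^ 2 := by
      intro u; rw [e]; simp
    refine ⟨fun u => ?_, ?_⟩
    · rw [hev]; exact Finset.sum_nonneg fun i _ => sq_nonneg _
    · have hI : ∀ i, h i ∈ Isub 3 T := by
        intro i
        refine mem_Isub.2 ⟨sos_hom hg6 e i, fun P hP => ?_⟩
        have h0 := hv P hP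
        unfold VanishAt at *
        rw [hev, Finset.sum_eq_zero_iff_of_nonneg (fun i _ => sq_nonneg _)] at h0
        simpa using h0 i (Finset.mem_univ _)
      rw [e]
      apply Submodule.sum_mem
      intro i _
      exact Submodule.subset_span ⟨h i, hI i, h i, hI i, sq _⟩
  · rintro ⟨hg, hgI⟩
    obtain ⟨c₁, h1, c₂, h2, rfl⟩ := psd_two_sq T hT8 hgen g hg hgI
    refine ⟨((mem_Isub.1 h1).1.pow 2).add ((mem_Isub.1 h2).1.pow 2),
      ⟨2, ![c₁, c₂], by simp [Fin.sum_univ_two]⟩, fun P hP => ?_⟩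
    have a1 := (mem_Isub.1 h1).2 P hP
    have a2 := (mem_Isub.1 h2).2 P hP
    unfold VanishAt at *
    simp [a1, a2]

end
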